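/- Let α = α_{(H₀,N₀)}, let I = M_{n,p}(𝕂) × {0} ⊂ 𝒢_{n,p}(𝕂), and let I^⊥ = {a ∈ 𝒢_{n,p}(𝕂) : δα(a,b) = 0 for all b ∈ I} be its orthogonal for δα. Then: (1) I^⊥ = {(x,u) : H₀·u = 0}; (2) I^⊥ is a Lie subalgebra of 𝒢_{n,p}(𝕂) and I is a Lie ideal of I^⊥; (3) the exact sequence 0 → I → I^⊥ → I^⊥/I → 0 splits, since S = {(0,u) : H₀·u = 0} is a Lie subalgebra with I^⊥ = I ⊕ S; (4) 𝒢_{n,p}(𝕂) decomposes as the direct sum of the Lie subalgebras I^⊥ and {0} × C(N₀), where C(N₀) = {u ∈ gl(n,𝕂) : u·N₀ = N₀·u}. -/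

import Mathlib

open Matrix

/-- The underlying space of the Lie algebra `𝒢_{n,p}(𝕂) = M_{n,p}(𝕂) × gl(n,𝕂)`. -/
abbrev GA (𝕂 : Type) [RCLike 𝕂] (n p : ℕ) : Type :=
  Matrix (Fin n) (Fin p) 𝕂 × Matrix (Fin n) (Fin n) 𝕂

/-- The Lie bracket `[(x,u),(y,v)] = (u·y − v·x, u·v − v·u)` of `𝒢_{n,p}(𝕂)`. -/
def bkt {𝕂 : Type} [RCLike 𝕂] {n p : ℕ} (a b : GA 𝕂 n p) : GA 𝕂 n p :=
  (a.2 * b.1 - b.2 * a.1, a.2 * b.2 - b.2 * a.2)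

/-- The block row `H₀ = (0,…,0,I_p) ∈ M_{p,n}(𝕂)`. -/
def H0 (𝕂 : Type) [RCLike 𝕂] (n p : ℕ) : Matrix (Fin p) (Fin n) 𝕂 :=
  Matrix.of fun i j => if (j : ℕ) = n - p + (i : ℕ) then 1 else 0

/-- The block subdiagonal matrix `N₀ ∈ gl(n,𝕂)`. -/
def N0 (𝕂 : Type) [RCLike 𝕂] (n p : ℕ) : Matrix (Fin n) (Fin n) 𝕂 :=
  Matrix.of fun i j => if (i : ℕ) = (j : ℕ) + p then 1 else 0

theorem H0_mul_apply {𝕂 : Type} [RCLike 𝕂] {n p : ℕ} (h : p ≤ n)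
    (u : Matrix (Fin n) (Fin n) 𝕂) (i : Fin p) (j : Fin n) :
    (H0 𝕂 n p * u) i j = u ⟨n - p + i, by omega⟩ j := by
  rw [Matrix.mul_apply, Finset.sum_eq_single ⟨n - p + i, by omega⟩]
  · simp [H0]
  · intro b _ hb
    have : (b : ℕ) ≠ n - p + i := fun e => hb (Fin.ext e)
    simp [H0, this]
  · simp

theorem N0_mul_apply {𝕂 : Type} [RCLike 𝕂] {n p : ℕ}
    (u : Matrix (Fin n) (Fin n) 𝕂) (i : Fin n) (j : Fin n) :
    (N0 𝕂 n p * u) i j = if p ≤ (i : ℕ) then u ⟨i - p, by omega⟩ j else 0 := by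
  rw [Matrix.mul_apply]
  split_ifs with h
  · rw [Finset.sum_eq_single ⟨i - p, by omega⟩]
    · simp [N0, h]
    · intro b _ hb
      have : (i : ℕ) ≠ b + p := fun e => hb (Fin.ext (by simp; omega))
      simp [N0, this]
    · simp
  · apply Finset.sum_eq_zero
    intro b _
    have : (i : ℕ) ≠ b + p := by omega
    simp [N0, this]

theorem mul_N0_apply {𝕂 : Type} [RCLike 𝕂] {n p : ℕ}
    (u : Matrix (Fin n) (Fin n) 𝕂) (i : Fin n) (j : Fin n) :
    (u * N0 𝕂 n p) i j = if h : (j : ℕ) + p < n then u i ⟨j + p, h⟩ else 0 := by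
  rw [Matrix.mul_apply]
  split_ifs with h
  · rw [Finset.sum_eq_single ⟨j + p, h⟩]
    · simp [N0]
    · intro b _ hb
      have : (b : ℕ) ≠ j + p := fun e => hb (Fin.ext e)
      simp [N0, this]
    · simp
  · apply Finset.sum_eq_zero
    intro b _
    have : (b : ℕ) ≠ j + p := by omega
    simp [N0, this]

theorem comm_uniq {𝕂 : Type} [RCLike 𝕂] {n p : ℕ} (hp : 1 ≤ p) (h : p ≤ n)
    (u : Matrix (Fin n) (Fin n) 𝕂) (hc : u * N0 𝕂 n p = N0 𝕂 n p * u)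
    (hH : H0 𝕂 n p * u = 0) : u = 0 := by
  have base : ∀ i : Fin n, n - p ≤ i → ∀ j, u i j = 0 := by
    intro i hi j
    have := H0_mul_apply h u ⟨i - (n - p), by omega⟩ j
    rw [hH] at this
    have e : (⟨n - p + (i - (n - p)), by omega⟩ : Fin n) = i := Fin.ext (by simp; omega)
    simp only [e] at this
    simpa using this.symm
  have key : ∀ t : ℕ, ∀ i : Fin n, n - p ≤ i + t → ∀ j, u i j = 0 := by
    intro t
    induction t with
    | zero => intro i hi; exact base i hi
    | succ t ih =>
      intro i hi j
      by_cases hb : n - p ≤ i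
      · exact base i hb j
      · have e := congrFun (congrFun hc ⟨i + p, by omega⟩) j
        rw [N0_mul_apply, mul_N0_apply] at e
        simp only [Nat.le_add_left, if_true, Nat.add_sub_cancel] at e
        rw [← Fin.eta i i.2, ← e]
        split_ifs
        · exact ih _ (by simp; omega) _
        · rfl
  ext i j
  exact key n i (by omega) j

theorem comm_exists {𝕂 : Type} [RCLike 𝕂] {n p k : ℕ} (hp : 1 ≤ p) (hk : 1 ≤ k)
    (hn : n = k * p) (R : Matrix (Fin p) (Fin n) 𝕂) :
    ∃ u : Matrix (Fin n) (Fin n) 𝕂, u * N0 𝕂 n p = N0 𝕂 n p * u ∧ H0 𝕂 n p * u = R := by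
  obtain ⟨k, rfl⟩ : ∃ l, k = l + 1 := ⟨k - 1, by omega⟩
  have hpn : p ≤ n := by rw [hn]; nlinarith
  have hnp : n = k * p + p := by rw [hn]; ring
  refine ⟨Matrix.of fun i j => if h : (j : ℕ) + (k - i / p) * p < n then
    R ⟨i % p, Nat.mod_lt _ hp⟩ ⟨j + (k - i / p) * p, h⟩ else 0, ?_, ?_⟩
  · ext i j
    rw [N0_mul_apply, mul_N0_apply]
    simp only [Matrix.of_apply]
    by_cases hi : p ≤ (i : ℕ)
    · have h1 : ((i : ℕ) - p) / p = i / p - 1 := by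
        have := Nat.sub_mul_div (i : ℕ) p 1
        simpa using this
      have h2 : ((i : ℕ) - p) % p = i % p := (Nat.mod_eq_sub_mod hi).symm
      have h3 : 1 ≤ (i : ℕ) / p := Nat.div_pos hi hp
      have h4 : (i : ℕ) / p ≤ k := by
        have : (i : ℕ) / p < k + 1 := Nat.div_lt_of_lt_mul (by rw [mul_comm, ← hn]; exact i.2)
        omega
      have h5 : (j : ℕ) + (k - (i / p - 1)) * p = j + p + (k - i / p) * p := by
        have : k - ((i : ℕ) / p - 1) = (k - i / p) + 1 := by omega
        rw [this]; ring
      simp only [hi, if_true, h1, h2, h5]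
      by_cases hj : (j : ℕ) + p < n
      · simp only [hj, dif_pos]
      · have : ¬ ((j : ℕ) + p + (k - i / p) * p < n) := by omega
        simp only [hj, this, dif_neg, not_false_eq_true]
    · have h0 : (i : ℕ) / p = 0 := Nat.div_eq_of_lt (by omega)
      have : ¬ ((j : ℕ) + p + k * p < n) := by omega
      simp [hi, h0, this]
  · ext i j
    rw [H0_mul_apply hpn]
    have e : n - p + (i : ℕ) = i + p * k := by rw [mul_comm p k]; omega
    have h1 : (n - p + (i : ℕ)) / p = k := by
      rw [e, Nat.add_mul_div_left _ _ hp, Nat.div_eq_of_lt i.2, zero_add]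
    have h2 : (n - p + (i : ℕ)) % p = i := by
      rw [e, Nat.add_mul_mod_self_left, Nat.mod_eq_of_lt i.2]
    simp [h1, h2]

/-- With `α = α_{(H₀,N₀)}`, `I = M_{n,p}(𝕂) × {0}` and `I^⊥` its `δα`-orthogonal:
(1) `I^⊥ = {(x,u) : H₀·u = 0}`; (2) `I^⊥` is a Lie subalgebra and `I` a Lie ideal of `I^⊥`;
(3) the sequence `0 → I → I^⊥ → I^⊥/I → 0` splits via the subalgebra `S = {(0,u) : H₀·u = 0}`,
`I^⊥ = I ⊕ S`; (4) `𝒢_{n,p}(𝕂)` is the direct sum of the Lie subalgebras `I^⊥` and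
`{0} × C(N₀)`. -/
theorem stmt10 (𝕂 : Type) [RCLike 𝕂] (p k n : ℕ) (hp : 1 ≤ p) (hk : 1 ≤ k)
    (hn : n = k * p) :
    let α : GA 𝕂 n p → 𝕂 := fun a => trace (a.1 * H0 𝕂 n p) + trace (N0 𝕂 n p * a.2)
    -- (1) I^⊥ = {(x,u) : H₀·u = 0}
    (∀ a : GA 𝕂 n p,
      (∀ b : GA 𝕂 n p, b.2 = 0 → -α (bkt a b) = 0) ↔ H0 𝕂 n p * a.2 = 0) ∧
    -- (2) I^⊥ is a Lie subalgebra …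
    (∀ a b : GA 𝕂 n p, H0 𝕂 n p * a.2 = 0 → H0 𝕂 n p * b.2 = 0 →
      H0 𝕂 n p * (bkt a b).2 = 0) ∧
    -- … and I is a two-sided Lie ideal of I^⊥
    (∀ a b : GA 𝕂 n p, H0 𝕂 n p * a.2 = 0 → b.2 = 0 →
      (bkt a b).2 = 0 ∧ (bkt b a).2 = 0) ∧
    -- (3) S = {(0,u) : H₀·u = 0} is a Lie subalgebra …
    (∀ a b : GA 𝕂 n p, a.1 = 0 → H0 𝕂 n p * a.2 = 0 → b.1 = 0 → H0 𝕂 n p * b.2 = 0 →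
      (bkt a b).1 = 0 ∧ H0 𝕂 n p * (bkt a b).2 = 0) ∧
    -- … splitting the sequence: I^⊥ = I ⊕ S
    (∀ a : GA 𝕂 n p, H0 𝕂 n p * a.2 = 0 →
      ∃! q : GA 𝕂 n p × GA 𝕂 n p,
        q.1.2 = 0 ∧ q.2.1 = 0 ∧ H0 𝕂 n p * q.2.2 = 0 ∧ a = q.1 + q.2) ∧
    -- (4) {0} × C(N₀) is a Lie subalgebra …
    (∀ a b : GA 𝕂 n p, a.1 = 0 → a.2 * N0 𝕂 n p = N0 𝕂 n p * a.2 →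
      b.1 = 0 → b.2 * N0 𝕂 n p = N0 𝕂 n p * b.2 →
      (bkt a b).1 = 0 ∧ (bkt a b).2 * N0 𝕂 n p = N0 𝕂 n p * (bkt a b).2) ∧
    -- … and 𝒢_{n,p}(𝕂) = I^⊥ ⊕ ({0} × C(N₀))
    (∀ a : GA 𝕂 n p, ∃! q : GA 𝕂 n p × GA 𝕂 n p,
      H0 𝕂 n p * q.1.2 = 0 ∧ q.2.1 = 0 ∧ q.2.2 * N0 𝕂 n p = N0 𝕂 n p * q.2.2 ∧
      a = q.1 + q.2) := by
  have hpn : p ≤ n := by rw [hn]; nlinarith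
  intro α
  refine ⟨?_, ?_, ?_, ?_, ?_, ?_, ?_⟩
  · intro a
    constructor
    · intro h
      rw [Matrix.ext_iff_trace_mul_right]
      intro y
      have := h (y, 0) rfl
      simp only [α, bkt, Matrix.zero_mul, Matrix.mul_zero, sub_zero, Matrix.trace_zero, add_zero,
        neg_eq_zero] at this
      rw [Matrix.trace_mul_comm, ← Matrix.mul_assoc] at this
      simpa using this
    · intro h b hb
      simp only [α, bkt, hb, Matrix.zero_mul, Matrix.mul_zero, sub_zero, Matrix.trace_zero,
        add_zero, neg_eq_zero]
      rw [Matrix.trace_mul_comm, ← Matrix.mul_assoc, h]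
      simp
  · intro a b ha hb
    simp [bkt, Matrix.mul_sub, ← Matrix.mul_assoc, ha, hb]
  · intro a b ha hb
    simp [bkt, hb]
  · intro a b ha1 ha hb1 hb
    simp [bkt, Matrix.mul_sub, ← Matrix.mul_assoc, ha, hb, ha1, hb1]
  · intro a ha
    refine ⟨((a.1, 0), (0, a.2)), ⟨rfl, rfl, ha, by simp⟩, ?_⟩
    rintro ⟨⟨x, u⟩, ⟨y, v⟩⟩ ⟨h1, h2, h3, h4⟩
    simp only at h1 h2
    subst h1 h2 h4
    simp
  · intro a b ha1 ha hb1 hb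
    refine ⟨by simp [bkt, ha1, hb1], ?_⟩
    have hA : Commute a.2 (N0 𝕂 n p) := ha
    have hB : Commute b.2 (N0 𝕂 n p) := hb
    exact ((hA.mul_left hB).sub_left (hB.mul_left hA))
  · intro a
    obtain ⟨u, hu, hR⟩ := comm_exists hp hk hn (H0 𝕂 n p * a.2)
    refine ⟨((a.1, a.2 - u), (0, u)), ⟨by simp [Matrix.mul_sub, hR], rfl, hu, by simp⟩, ?_⟩
    rintro ⟨⟨x, w⟩, ⟨y, v⟩⟩ ⟨h1, h2, h3, h4⟩
    simp only at h1 h2 h3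
    subst h2 h4
    have hv : v - u = 0 := by
      apply comm_uniq hp hpn
      · rw [Matrix.sub_mul, Matrix.mul_sub, h3, hu]
      · rw [Matrix.mul_sub, hR]
        simp [Matrix.mul_add, h1]
    have : v = u := sub_eq_zero.mp hv
    subst this
    simp
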